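/- arXiv:2604.02525 — 4 statements merged into one kernel-verified Lean document; each statement's English description precedes it below -/
import Mathlib

section
/- Let m, k ≥ 1, let H be a real m×m matrix with Hᵀ * H = I and |H_{ip}| = 1/√m for all i, p, and let A be a nonzero real m×k matrix supported on a single row r (i.e., A_{ij} = 0 whenever i ≠ r). Then γ(H * A) = γ(A) / m, where γ denotes the outlier factor. That is, left multiplication by a normalized Hadamard matrix reduces the outlier factor of a row-concentrated matrix exactly by the factor m. -/
open Matrix BigOperators

/-- The Frobenius norm of a real matrix: `‖M‖_F = sqrt (∑ i j, (M i j)^2)`. -/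
noncomputable def frob {m n : ℕ} (M : Matrix (Fin m) (Fin n) ℝ) : ℝ :=
  Real.sqrt (∑ i, ∑ j, (M i j) ^ 2)

/-- The maximum absolute value of an entry of a real matrix. -/
noncomputable def maxAbs {m n : ℕ} (M : Matrix (Fin m) (Fin n) ℝ) : ℝ :=
  ⨆ i, ⨆ j, |M i j|

/-- The outlier factor `γ(M) = m·n·(max_{i,j} |M_{ij}|)² / ‖M‖_F²` of a real
`m × n` matrix, measuring how concentrated its energy is in extreme values. -/
noncomputable def outlierFactor {m n : ℕ} (M : Matrix (Fin m) (Fin n) ℝ) : ℝ :=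
  (m * n : ℝ) * (maxAbs M) ^ 2 / (frob M) ^ 2

/-- If `A` is supported on row `r`, then `H * A` is the outer product of column `r` of `H`
and row `r` of `A`. -/
theorem mul_apply_of_single_row {l m k : ℕ} (H : Matrix (Fin l) (Fin m) ℝ)
    {A : Matrix (Fin m) (Fin k) ℝ} {r : Fin m} (hrow : ∀ i j, i ≠ r → A i j = 0)
    (i : Fin l) (j : Fin k) : (H * A) i j = H i r * A r j := by
  rw [Matrix.mul_apply]
  exact Finset.sum_eq_single r (fun p _ hp => by rw [hrow p j hp, mul_zero]) (by simp)

theorem maxAbs_of_single_row {m k : ℕ} {A : Matrix (Fin m) (Fin k) ℝ} {r : Fin m}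
    (hrow : ∀ i j, i ≠ r → A i j = 0) : maxAbs A = ⨆ j, |A r j| := by
  have : Nonempty (Fin m) := ⟨r⟩
  refine le_antisymm (ciSup_le fun i => ?_)
    (le_ciSup (f := fun i => ⨆ j, |A i j|) (Set.finite_range _).bddAbove r)
  by_cases hi : i = r
  · rw [hi]
  · simp only [hrow i _ hi, abs_zero, Real.iSup_const_zero]
    exact Real.iSup_nonneg fun j => abs_nonneg _

theorem frob_sq {m k : ℕ} (A : Matrix (Fin m) (Fin k) ℝ) :
    frob A ^ 2 = ∑ i, ∑ j, A i j ^ 2 :=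
  Real.sq_sqrt (Finset.sum_nonneg fun _ _ => Finset.sum_nonneg fun _ _ => sq_nonneg _)

/-- Multiplication by a matrix with orthonormal columns preserves the Frobenius norm. -/
theorem frob_mul_sq_of_transpose_mul_self {l m k : ℕ} {H : Matrix (Fin l) (Fin m) ℝ}
    (hH : Hᵀ * H = 1) (A : Matrix (Fin m) (Fin k) ℝ) : frob (H * A) ^ 2 = frob A ^ 2 := by
  have frob_sq_eq_trace {n : ℕ} (B : Matrix (Fin n) (Fin k) ℝ) :
      frob B ^ 2 = (Bᵀ * B).trace := by
    rw [frob_sq, Finset.sum_comm]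
    simp [Matrix.trace, Matrix.mul_apply, sq]
  rw [frob_sq_eq_trace, frob_sq_eq_trace, Matrix.transpose_mul, Matrix.mul_assoc,
    ← Matrix.mul_assoc Hᵀ, hH, Matrix.one_mul]

/-- Left multiplication by a normalized Hadamard matrix reduces the
outlier factor of a row-concentrated (single-row-supported) matrix exactly by
the factor `m`: `γ(H * A) = γ(A) / m`. -/
theorem outlierFactor_left_hadamard_single_row {m k : ℕ} (hm : 1 ≤ m) (hk : 1 ≤ k)
    (H : Matrix (Fin m) (Fin m) ℝ) (hH : Hᵀ * H = 1)
    (hHe : ∀ i p, |H i p| = 1 / Real.sqrt m)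
    (A : Matrix (Fin m) (Fin k) ℝ) (hA : A ≠ 0)
    (r : Fin m) (hrow : ∀ i j, i ≠ r → A i j = 0) :
    outlierFactor (H * A) = outlierFactor A / m := by
  have : Nonempty (Fin m) := ⟨r⟩
  have hmax : maxAbs (H * A) = 1 / Real.sqrt m * maxAbs A := by
    rw [maxAbs_of_single_row hrow, Real.mul_iSup_of_nonneg (by positivity)]
    simp only [maxAbs, mul_apply_of_single_row H hrow, abs_mul, hHe, ciSup_const]
  rw [outlierFactor, outlierFactor, frob_mul_sq_of_transpose_mul_self hH, hmax, mul_pow,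
    div_pow, Real.sq_sqrt (Nat.cast_nonneg m)]
  ring
end

section
/- Let k, n ≥ 1, let H be a real n×n matrix with Hᵀ * H = I and |H_{ip}| = 1/√n for all i, p, and let B be a nonzero real k×n matrix supported on a single column c (i.e., B_{ij} = 0 whenever j ≠ c). Then γ(B * H) = γ(B) / n, where γ denotes the outlier factor. That is, right multiplication by a normalized Hadamard matrix reduces the outlier factor of a column-concentrated matrix exactly by the factor n. -/
open Matrix BigOperators

/-- If all entries in each row `i` have absolute value `v i`, then the maximal absolute value
is the supremum of the `v i`. -/
theorem maxAbs_eq_iSup_of_abs_eq {m n : ℕ} [Nonempty (Fin n)] (M : Matrix (Fin m) (Fin n) ℝ)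
    (v : Fin m → ℝ) (h : ∀ i j, |M i j| = v i) : maxAbs M = ⨆ i, v i := by
  simp only [maxAbs, h, ciSup_const]

/-- The maximal absolute value of a matrix supported on a single column. -/
theorem maxAbs_of_single_col {m n : ℕ} (B : Matrix (Fin m) (Fin n) ℝ) (c : Fin n)
    (hcol : ∀ i j, j ≠ c → B i j = 0) : maxAbs B = ⨆ i, |B i c| := by
  have : Nonempty (Fin n) := ⟨c⟩
  refine iSup_congr fun i => le_antisymm (ciSup_le fun j => ?_)
    (le_ciSup (f := fun j => |B i j|) (Set.finite_range _).bddAbove c)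
  by_cases hj : j = c
  · rw [hj]
  · simp [hcol i j hj]

theorem mul_apply_of_single_col {m n p : ℕ} (B : Matrix (Fin m) (Fin n) ℝ) (c : Fin n)
    (hcol : ∀ i j, j ≠ c → B i j = 0) (H : Matrix (Fin n) (Fin p) ℝ) (i : Fin m) (j : Fin p) :
    (B * H) i j = B i c * H c j := by
  rw [Matrix.mul_apply]
  exact Finset.sum_eq_single c (fun l _ hl => by simp [hcol i l hl]) (by simp)

/-- Right multiplication by a normalized Hadamard matrix reduces the
outlier factor of a column-concentrated (single-column-supported) matrix
exactly by the factor `n`: `γ(B * H) = γ(B) / n`. -/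
theorem outlierFactor_right_hadamard_single_col {k n : ℕ} (hk : 1 ≤ k) (hn : 1 ≤ n)
    (H : Matrix (Fin n) (Fin n) ℝ) (hH : Hᵀ * H = 1)
    (hHe : ∀ i p, |H i p| = 1 / Real.sqrt n)
    (B : Matrix (Fin k) (Fin n) ℝ) (hB : B ≠ 0)
    (c : Fin n) (hcol : ∀ i j, j ≠ c → B i j = 0) :
    outlierFactor (B * H) = outlierFactor B / n := by
  have hne : Nonempty (Fin n) := ⟨c⟩
  have hn0 : (n : ℝ) ≠ 0 := by positivity
  have hmul := mul_apply_of_single_col B c hcol H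
  have hmax : maxAbs (B * H) = maxAbs B * (1 / Real.sqrt n) := by
    rw [maxAbs_of_single_col B c hcol, Real.iSup_mul_of_nonneg (by positivity)]
    exact maxAbs_eq_iSup_of_abs_eq _ _ fun i j => by rw [hmul, abs_mul, hHe]
  have hfrob : frob (B * H) = frob B := by
    refine congrArg Real.sqrt (Finset.sum_congr rfl fun i _ => ?_)
    have hsq : ∀ p, (H c p) ^ 2 = 1 / n := fun p => by
      rw [← sq_abs, hHe, div_pow, Real.sq_sqrt n.cast_nonneg, one_pow]
    have hB' : ∑ j, (B i j) ^ 2 = (B i c) ^ 2 :=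
      Finset.sum_eq_single c (fun l _ hl => by simp [hcol i l hl]) (by simp)
    simp only [hmul, mul_pow, hsq, hB', Finset.sum_const, Finset.card_univ, Fintype.card_fin,
      nsmul_eq_mul]
    field_simp
  rw [outlierFactor, outlierFactor, hmax, hfrob, mul_pow, div_pow, Real.sq_sqrt n.cast_nonneg]
  ring
end

section
/- Let m, k ≥ 1, let H be a real m×m matrix with Hᵀ * H = I and |H_{ip}| ≤ 1/√m for all i, p, let S be a finite set of row indices with |S| = s, and let A be a nonzero real m×k matrix supported on the rows in S (i.e., A_{ij} = 0 whenever i ∉ S). Then max_{i,j} |(H*A)_{ij}| ≤ (s/√m) · max_{i,j} |A_{ij}|, and consequently γ(H * A) ≤ (s²/m) · γ(A). -/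
open Matrix BigOperators

theorem maxAbs_nonneg {m n : ℕ} (M : Matrix (Fin m) (Fin n) ℝ) : 0 ≤ maxAbs M :=
  Real.iSup_nonneg fun _ => Real.iSup_nonneg fun _ => abs_nonneg _

theorem abs_apply_le_maxAbs {m n : ℕ} (M : Matrix (Fin m) (Fin n) ℝ) (i : Fin m) (j : Fin n) :
    |M i j| ≤ maxAbs M :=
  (le_ciSup (f := fun j => |M i j|) (Set.finite_range _).bddAbove j).trans
    (le_ciSup (f := fun i => ⨆ j, |M i j|) (Set.finite_range _).bddAbove i)

theorem maxAbs_le {m n : ℕ} {M : Matrix (Fin m) (Fin n) ℝ} {c : ℝ} (hc : 0 ≤ c)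
    (h : ∀ i j, |M i j| ≤ c) : maxAbs M ≤ c :=
  Real.iSup_le (fun i => Real.iSup_le (h i) hc) hc

theorem frob_eq_sqrt_trace {m n : ℕ} (M : Matrix (Fin m) (Fin n) ℝ) :
    frob M = Real.sqrt (Mᵀ * M).trace := by
  rw [frob, Finset.sum_comm]
  simp [Matrix.trace, Matrix.mul_apply, sq]

/-- The Frobenius norm is invariant under left multiplication by a matrix with orthonormal
columns. -/
theorem frob_mul_of_transpose_mul_self {l m n : ℕ} {H : Matrix (Fin l) (Fin m) ℝ}
    (hH : Hᵀ * H = 1) (A : Matrix (Fin m) (Fin n) ℝ) : frob (H * A) = frob A := by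
  rw [frob_eq_sqrt_trace, frob_eq_sqrt_trace, Matrix.transpose_mul, Matrix.mul_assoc,
    ← Matrix.mul_assoc Hᵀ, hH, Matrix.one_mul]

theorem maxAbs_mul_le_of_support {l m n : ℕ} {H : Matrix (Fin l) (Fin m) ℝ} {c : ℝ} (hc : 0 ≤ c)
    (hHe : ∀ i p, |H i p| ≤ c) (S : Finset (Fin m)) {A : Matrix (Fin m) (Fin n) ℝ}
    (hsupp : ∀ i j, i ∉ S → A i j = 0) : maxAbs (H * A) ≤ S.card * c * maxAbs A := by
  have hA := maxAbs_nonneg A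
  refine maxAbs_le (by positivity) fun i j => ?_
  have hsum : (H * A) i j = ∑ p ∈ S, H i p * A p j := by
    rw [Matrix.mul_apply]
    exact (Finset.sum_subset S.subset_univ fun p _ hp => by rw [hsupp p j hp, mul_zero]).symm
  calc |(H * A) i j| ≤ ∑ p ∈ S, |H i p * A p j| := hsum ▸ Finset.abs_sum_le_sum_abs _ _
    _ ≤ ∑ _p ∈ S, c * maxAbs A := Finset.sum_le_sum fun p _ => by
      rw [abs_mul]
      exact mul_le_mul (hHe i p) (abs_apply_le_maxAbs A p j) (abs_nonneg _) hc
    _ = S.card * c * maxAbs A := by rw [Finset.sum_const, nsmul_eq_mul, mul_assoc]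

/-- If `A` is supported on `s` rows and `H` is a (normalized-entry)
orthogonal `m × m` matrix with entries bounded by `1/√m`, then
`max_{i,j} |(H*A)_{ij}| ≤ (s/√m) · max_{i,j} |A_{ij}|` and consequently
`γ(H * A) ≤ (s²/m) · γ(A)`. -/
theorem outlierFactor_left_hadamard_s_rows {m k : ℕ} (hm : 1 ≤ m) (hk : 1 ≤ k)
    (H : Matrix (Fin m) (Fin m) ℝ) (hH : Hᵀ * H = 1)
    (hHe : ∀ i p, |H i p| ≤ 1 / Real.sqrt m)
    (S : Finset (Fin m)) (s : ℕ) (hS : S.card = s)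
    (A : Matrix (Fin m) (Fin k) ℝ) (hA : A ≠ 0)
    (hsupp : ∀ i j, i ∉ S → A i j = 0) :
    maxAbs (H * A) ≤ (s / Real.sqrt m) * maxAbs A ∧
      outlierFactor (H * A) ≤ ((s : ℝ) ^ 2 / m) * outlierFactor A := by
  have hmax : maxAbs (H * A) ≤ (s / Real.sqrt m) * maxAbs A := by
    have h := maxAbs_mul_le_of_support (by positivity) hHe S hsupp
    rwa [hS, mul_one_div] at h
  refine ⟨hmax, ?_⟩
  have hsq : maxAbs (H * A) ^ 2 ≤ (s : ℝ) ^ 2 / m * maxAbs A ^ 2 := by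
    have h := pow_le_pow_left₀ (maxAbs_nonneg _) hmax 2
    rwa [mul_pow, div_pow, Real.sq_sqrt (Nat.cast_nonneg m)] at h
  rw [outlierFactor, outlierFactor, frob_mul_of_transpose_mul_self hH]
  calc (m * k : ℝ) * maxAbs (H * A) ^ 2 / frob A ^ 2
      ≤ (m * k : ℝ) * ((s : ℝ) ^ 2 / m * maxAbs A ^ 2) / frob A ^ 2 := by gcongr
    _ = (s : ℝ) ^ 2 / m * ((m * k : ℝ) * maxAbs A ^ 2 / frob A ^ 2) := by ring
end

section
/- Let k, n ≥ 1, let H be a real n×n matrix with Hᵀ * H = I and |H_{ip}| ≤ 1/√n for all i, p, let S be a finite set of column indices with |S| = s, and let B be a nonzero real k×n matrix supported on the columns in S (i.e., B_{ij} = 0 whenever j ∉ S). Then max_{i,j} |(B*H)_{ij}| ≤ (s/√n) · max_{i,j} |B_{ij}|, and consequently γ(B * H) ≤ (s²/n) · γ(B). -/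
open Matrix BigOperators

theorem frob_sq_s9 {m n : ℕ} (M : Matrix (Fin m) (Fin n) ℝ) : frob M ^ 2 = (M * Mᵀ).trace := by
  rw [frob, Real.sq_sqrt (by positivity)]
  simp [Matrix.trace, Matrix.mul_apply, sq]

/-- Right multiplication by an orthogonal matrix preserves the Frobenius norm. -/
theorem frob_mul_sq {m n : ℕ} (B : Matrix (Fin m) (Fin n) ℝ) {H : Matrix (Fin n) (Fin n) ℝ}
    (hH : Hᵀ * H = 1) : frob (B * H) ^ 2 = frob B ^ 2 := by
  have hH' : H * Hᵀ = 1 := mul_eq_one_comm.mp hH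
  rw [frob_sq_s9, frob_sq_s9, Matrix.transpose_mul, Matrix.mul_assoc, ← Matrix.mul_assoc H, hH',
    Matrix.one_mul]

theorem abs_mul_apply_le_of_support {m n p : ℕ} {B : Matrix (Fin m) (Fin n) ℝ}
    {H : Matrix (Fin n) (Fin p) ℝ} {S : Finset (Fin n)} {c : ℝ} (hHe : ∀ i j, |H i j| ≤ c)
    (hsupp : ∀ i j, j ∉ S → B i j = 0) (i : Fin m) (j : Fin p) :
    |(B * H) i j| ≤ S.card * c * maxAbs B := by
  have hsum : (B * H) i j = ∑ l ∈ S, B i l * H l j := by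
    rw [Matrix.mul_apply]
    refine (Finset.sum_subset (Finset.subset_univ S) fun l _ hl => ?_).symm
    rw [hsupp i l hl, zero_mul]
  calc |(B * H) i j| ≤ ∑ l ∈ S, |B i l * H l j| := hsum ▸ Finset.abs_sum_le_sum_abs _ _
    _ ≤ ∑ _l ∈ S, maxAbs B * c := by
      refine Finset.sum_le_sum fun l _ => ?_
      rw [abs_mul]
      exact mul_le_mul (abs_apply_le_maxAbs B i l) (hHe l j) (abs_nonneg _) (maxAbs_nonneg B)
    _ = S.card * c * maxAbs B := by
      rw [Finset.sum_const, nsmul_eq_mul]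
      ring

/-- If `B` is supported on `s` columns and `H` is a
(normalized-entry) orthogonal `n × n` matrix with entries bounded by `1/√n`,
then `max_{i,j} |(B*H)_{ij}| ≤ (s/√n) · max_{i,j} |B_{ij}|` and consequently
`γ(B * H) ≤ (s²/n) · γ(B)`. -/
theorem outlierFactor_right_hadamard_s_cols {k n : ℕ} (hk : 1 ≤ k) (hn : 1 ≤ n)
    (H : Matrix (Fin n) (Fin n) ℝ) (hH : Hᵀ * H = 1)
    (hHe : ∀ i p, |H i p| ≤ 1 / Real.sqrt n)
    (S : Finset (Fin n)) (s : ℕ) (hS : S.card = s)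
    (B : Matrix (Fin k) (Fin n) ℝ) (hB : B ≠ 0)
    (hsupp : ∀ i j, j ∉ S → B i j = 0) :
    maxAbs (B * H) ≤ (s / Real.sqrt n) * maxAbs B ∧
      outlierFactor (B * H) ≤ ((s : ℝ) ^ 2 / n) * outlierFactor B := by
  have hmax : maxAbs (B * H) ≤ (s / Real.sqrt n) * maxAbs B := by
    refine maxAbs_le (mul_nonneg (by positivity) (maxAbs_nonneg B)) fun i j => ?_
    refine (abs_mul_apply_le_of_support hHe hsupp i j).trans_eq ?_
    rw [hS, mul_one_div]
  refine ⟨hmax, ?_⟩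
  have hsq : maxAbs (B * H) ^ 2 ≤ (s : ℝ) ^ 2 / n * maxAbs B ^ 2 := by
    refine (pow_le_pow_left₀ (maxAbs_nonneg _) hmax 2).trans_eq ?_
    rw [mul_pow, div_pow, Real.sq_sqrt n.cast_nonneg]
  calc outlierFactor (B * H) = (k * n : ℝ) * maxAbs (B * H) ^ 2 / frob B ^ 2 := by
        rw [outlierFactor, frob_mul_sq B hH]
    _ ≤ (k * n : ℝ) * ((s : ℝ) ^ 2 / n * maxAbs B ^ 2) / frob B ^ 2 := by gcongr
    _ = ((s : ℝ) ^ 2 / n) * outlierFactor B := by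
        rw [outlierFactor]
        ring
end
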